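/- Let q ∈ (1,2] and let Ω ⊆ ℝ^N be open with λ₁(Ω,s,q) > 0, and assume the embedding 𝒦(Ω) ↪ L^q(Ω) is compact. If λ > 0 is a q-semilinear s-eigenvalue of Ω admitting a q-semilinear s-eigenfunction u with u ≥ 0 a.e. in Ω, then λ = λ₁(Ω,s,q). -/

import Mathlib

open MeasureTheory Filter Topology
open scoped ENNReal RealInnerProductSpace

noncomputable section

abbrev Euc (N : ℕ) := EuclideanSpace ℝ (Fin N)

/-- Gagliardo energy `[u]_s²`. -/
def gagliardo (N : ℕ) (s : ℝ) (u : Euc N → ℝ) : ℝ≥0∞ :=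
  ∫⁻ x : Euc N, ∫⁻ y : Euc N, ENNReal.ofReal ((u x - u y) ^ 2 / ‖x - y‖ ^ ((N : ℝ) + 2 * s))

/-- membership in the concrete model of `𝒟^{s,2}_0(Ω)`. -/
def memK (N : ℕ) (s : ℝ) (Ω : Set (Euc N)) (u : Euc N → ℝ) : Prop :=
  Measurable u ∧ (∀ᵐ x : Euc N ∂volume, x ∉ Ω → u x = 0) ∧ gagliardo N s u < ⊤

/-- first `q`-semilinear `s`-eigenvalue. -/
def lambda1 (N : ℕ) (s q : ℝ) (Ω : Set (Euc N)) : ℝ≥0∞ :=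
  ⨅ u ∈ {u : Euc N → ℝ | memK N s Ω u ∧ (∫ x in Ω, |u x| ^ q) = 1}, gagliardo N s u

/-- nonlocal bilinear form. -/
def dform (N : ℕ) (s : ℝ) (u φ : Euc N → ℝ) : ℝ :=
  ∫ p : Euc N × Euc N, (u p.1 - u p.2) * (φ p.1 - φ p.2) / ‖p.1 - p.2‖ ^ ((N : ℝ) + 2 * s)

/-- compactness of the embedding `𝒦(Ω) ↪ L^q(Ω)`. -/
def compactEmbed (N : ℕ) (s q : ℝ) (Ω : Set (Euc N)) : Prop :=
  ∀ u : ℕ → Euc N → ℝ, (∀ n, memK N s Ω (u n)) →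
    (∃ C : ℝ≥0∞, C < ⊤ ∧ ∀ n, gagliardo N s (u n) ≤ C) →
    ∃ (σ : ℕ → ℕ) (v : Euc N → ℝ), StrictMono σ ∧
      Tendsto (fun k => ∫ x in Ω, |u (σ k) x - v x| ^ q) atTop (𝓝 0)

/-- `q`-semilinear `s`-eigenfunction with eigenvalue `lam`. -/
def isEigenfunction (N : ℕ) (s q : ℝ) (Ω : Set (Euc N)) (lam : ℝ) (u : Euc N → ℝ) : Prop :=
  memK N s Ω u ∧ 0 < ∫ x in Ω, |u x| ^ q ∧
  ∀ φ : Euc N → ℝ, memK N s Ω φ →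
    dform N s u φ
      = lam * (∫ x in Ω, |u x| ^ q) ^ ((2 - q) / q) * ∫ x in Ω, |u x| ^ (q - 2) * u x * φ x

/-- `q`-semilinear `s`-eigenvalue. -/
def isEigenvalue (N : ℕ) (s q : ℝ) (Ω : Set (Euc N)) (lam : ℝ) : Prop :=
  0 < lam ∧ ∃ u : Euc N → ℝ, isEigenfunction N s q Ω lam u

/-- free energy functional `J_Ω`. -/
def freeEnergy (N : ℕ) (s q : ℝ) (Ω : Set (Euc N)) (φ : Euc N → ℝ) : ℝ :=
  (1 / 2) * (gagliardo N s φ).toReal - (1 / q) * ∫ x in Ω, φ x ^ q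

/-- Lane–Emden density of `Ω`: minimizer of the free energy among nonnegative members of `𝒦(Ω)`. -/
def isLaneEmden (N : ℕ) (s q : ℝ) (Ω : Set (Euc N)) (w : Euc N → ℝ) : Prop :=
  memK N s Ω w ∧ (∀ᵐ x : Euc N ∂volume, 0 ≤ w x) ∧
  ∀ φ : Euc N → ℝ, memK N s Ω φ → (∀ᵐ x : Euc N ∂volume, 0 ≤ φ x) →
    freeEnergy N s q Ω w ≤ freeEnergy N s q Ω φ

/-- weak solution of the fractional Lane–Emden equation in `Ω`. -/
def isWeakSolutionLE (N : ℕ) (s q : ℝ) (Ω : Set (Euc N)) (u : Euc N → ℝ) : Prop :=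
  memK N s Ω u ∧ ∀ φ : Euc N → ℝ, memK N s Ω φ →
    dform N s u φ = ∫ x in Ω, |u x| ^ (q - 2) * u x * φ x

/-- nonlocal tail. -/
def nlTail (N : ℕ) (s : ℝ) (w : Euc N → ℝ) (x₀ : Euc N) (ρ : ℝ) : ℝ :=
  ρ ^ (2 * s) * ∫ x in (Metric.ball x₀ ρ)ᶜ, |w x| / ‖x - x₀‖ ^ ((N : ℝ) + 2 * s)

lemma mul_div_rpow_self {x y q : ℝ} (hx : 0 < x) (hy : 0 ≤ y) :
    x * (y / x) ^ q = y ^ q * x ^ (1 - q) := by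
  rw [Real.div_rpow hy hx.le, Real.rpow_sub hx, Real.rpow_one]
  ring

lemma add_rpow_mul_rpow_le {q b c x y : ℝ} (hq : 1 ≤ q) (hb : 0 < b) (hc : 0 < c)
    (hx : 0 ≤ x) (hy : 0 ≤ y) :
    (x + y) ^ q * (b + c) ^ (1 - q) ≤ x ^ q * b ^ (1 - q) + y ^ q * c ^ (1 - q) := by
  have hbc : 0 < b + c := add_pos hb hc
  have h := (convexOn_rpow hq).2 (show x / b ∈ Set.Ici 0 from div_nonneg hx hb.le)
    (show y / c ∈ Set.Ici 0 from div_nonneg hy hc.le) (div_pos hb hbc).le (div_pos hc hbc).le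
    (by field_simp)
  simp only [smul_eq_mul] at h
  have e : b / (b + c) * (x / b) + c / (b + c) * (y / c) = (x + y) / (b + c) := by
    field_simp
  rw [e] at h
  rw [← mul_div_rpow_self hbc (add_nonneg hx hy), ← mul_div_rpow_self hb hx,
    ← mul_div_rpow_self hc hy]
  calc (b + c) * ((x + y) / (b + c)) ^ q
      ≤ (b + c) * (b / (b + c) * (x / b) ^ q + c / (b + c) * (y / c) ^ q) := by gcongr
    _ = _ := by field_simp

lemma discrete_picone_of_lt {q a b α β : ℝ} (hq : 1 ≤ q) (hb : 0 < b) (hab : b < a)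
    (hα : 0 ≤ α) (hβ : 0 ≤ β) :
    (a - b) * (α ^ q * a ^ (1 - q) - β ^ q * b ^ (1 - q))
      ≤ |α - β| ^ q * |a - b| ^ (2 - q) := by
  have hc : 0 < a - b := sub_pos.2 hab
  have h := add_rpow_mul_rpow_le hq hb hc hβ (abs_nonneg (α - β))
  have h1 : α ^ q ≤ (β + |α - β|) ^ q :=
    Real.rpow_le_rpow hα (by linarith [le_abs_self (α - β)]) (by linarith)
  have ha : 0 ≤ a ^ (1 - q) := Real.rpow_nonneg (hb.trans hab).le _
  rw [add_sub_cancel] at h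
  have h2 := mul_le_mul_of_nonneg_right h1 ha
  have e : (a - b) ^ (2 - q) = (a - b) * (a - b) ^ (1 - q) := by
    rw [show 2 - q = 1 + (1 - q) by ring, Real.rpow_add hc, Real.rpow_one]
  rw [abs_of_pos hc, e]
  calc _ ≤ (a - b) * (|α - β| ^ q * (a - b) ^ (1 - q)) := by gcongr; linarith
    _ = _ := by ring

/-- Discrete Picone inequality. -/
lemma discrete_picone {q a b α β : ℝ} (hq : 1 ≤ q) (ha : 0 < a) (hb : 0 < b)
    (hα : 0 ≤ α) (hβ : 0 ≤ β) :
    (a - b) * (α ^ q * a ^ (1 - q) - β ^ q * b ^ (1 - q))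
      ≤ |α - β| ^ q * |a - b| ^ (2 - q) := by
  rcases lt_trichotomy a b with h | rfl | h
  · have := discrete_picone_of_lt hq ha h hβ hα
    rw [abs_sub_comm α, abs_sub_comm a]
    linarith
  · rw [sub_self, zero_mul]
    positivity
  · exact discrete_picone_of_lt hq hb h hα hβ

lemma abs_rpow_sub_rpow_le {q M a b : ℝ} (hq : 1 ≤ q) (ha : a ∈ Set.Icc 0 M)
    (hb : b ∈ Set.Icc 0 M) : |a ^ q - b ^ q| ≤ q * M ^ (q - 1) * |a - b| := by
  refine Convex.norm_image_sub_le_of_norm_deriv_le (s := Set.Icc 0 M) (f := fun x : ℝ => x ^ q)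
    (fun x _ => (Real.hasDerivAt_rpow_const (Or.inr hq)).differentiableAt) (fun x hx => ?_)
    (convex_Icc 0 M) hb ha
  have h0 : 0 ≤ x ^ (q - 1) := Real.rpow_nonneg hx.1 _
  rw [(Real.hasDerivAt_rpow_const (Or.inr hq)).deriv, Real.norm_of_nonneg (by positivity)]
  have := Real.rpow_le_rpow hx.1 hx.2 (sub_nonneg.2 hq)
  gcongr

lemma abs_rpow_one_sub_sub_le {q ε a b : ℝ} (hq : 1 ≤ q) (hε : 0 < ε) (ha : ε ≤ a)
    (hb : ε ≤ b) : |a ^ (1 - q) - b ^ (1 - q)| ≤ (q - 1) * ε ^ (-q) * |a - b| := by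
  refine Convex.norm_image_sub_le_of_norm_deriv_le (s := Set.Ici ε)
    (f := fun x : ℝ => x ^ (1 - q)) (fun x hx =>
      (Real.hasDerivAt_rpow_const (Or.inl (hε.trans_le hx).ne')).differentiableAt)
    (fun x hx => ?_) (convex_Ici ε) hb ha
  have hx0 : 0 < x := hε.trans_le hx
  rw [(Real.hasDerivAt_rpow_const (Or.inl hx0.ne')).deriv, norm_mul, Real.norm_eq_abs,
    Real.norm_eq_abs, abs_of_nonpos (by linarith : 1 - q ≤ 0),
    abs_of_nonneg (Real.rpow_nonneg hx0.le _), neg_sub, show 1 - q - 1 = -q by ring]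
  have := Real.rpow_le_rpow_of_nonpos hε hx (by linarith : -q ≤ 0)
  have : 0 ≤ q - 1 := by linarith
  gcongr

lemma abs_mul_sub_mul_le {f f' g g' A B : ℝ} (hf : |f'| ≤ A) (hg : |g| ≤ B) :
    |f * g - f' * g'| ≤ B * |f - f'| + A * |g - g'| := by
  rw [show f * g - f' * g' = g * (f - f') + f' * (g - g') by ring]
  refine (abs_add_le _ _).trans ?_
  rw [abs_mul, abs_mul]
  gcongr

/-- The increment `u(x) - u(y)`. -/
def incr (N : ℕ) (u : Euc N → ℝ) (p : Euc N × Euc N) : ℝ := u p.1 - u p.2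

/-- The density `|x - y|^{-(N+2s)}`. -/
def gagliardoKernel (N : ℕ) (s : ℝ) (p : Euc N × Euc N) : ℝ≥0∞ :=
  ENNReal.ofReal (‖p.1 - p.2‖ ^ ((N : ℝ) + 2 * s))⁻¹

/-- The measure `|x - y|^{-(N+2s)} dx dy`. -/
def gagliardoMeasure (N : ℕ) (s : ℝ) : Measure (Euc N × Euc N) :=
  volume.withDensity (gagliardoKernel N s)

section Form

variable {N : ℕ} {s : ℝ} {u v φ : Euc N → ℝ}

lemma measurable_gagliardoKernel : Measurable (gagliardoKernel N s) := by
  unfold gagliardoKernel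
  fun_prop

lemma measurable_incr (hu : Measurable u) : Measurable (incr N u) := by
  unfold incr
  fun_prop

lemma gagliardo_eq_lintegral (hu : Measurable u) :
    gagliardo N s u = ∫⁻ p, ENNReal.ofReal (incr N u p ^ 2) ∂gagliardoMeasure N s := by
  rw [gagliardoMeasure, lintegral_withDensity_eq_lintegral_mul _ measurable_gagliardoKernel
    ((measurable_incr hu).pow_const 2).ennreal_ofReal, Measure.volume_eq_prod, lintegral_prod]
  · unfold gagliardo
    refine lintegral_congr fun x => lintegral_congr fun y => ?_
    rw [Pi.mul_apply, gagliardoKernel, ← ENNReal.ofReal_mul (by positivity), incr, div_eq_inv_mul]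
  · exact (measurable_gagliardoKernel.mul
      ((measurable_incr hu).pow_const 2).ennreal_ofReal).aemeasurable

lemma dform_eq_integral :
    dform N s u φ = ∫ p, incr N u p * incr N φ p ∂gagliardoMeasure N s := by
  rw [gagliardoMeasure, integral_withDensity_eq_integral_toReal_smul measurable_gagliardoKernel
    (Eventually.of_forall fun _ => ENNReal.ofReal_lt_top)]
  unfold dform
  refine integral_congr_ae (Eventually.of_forall fun p => ?_)
  simp only [gagliardoKernel, incr, smul_eq_mul]
  rw [ENNReal.toReal_ofReal (by positivity), div_eq_inv_mul]

lemma gagliardo_lt_top_iff (hu : Measurable u) :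
    gagliardo N s u < ⊤ ↔ MemLp (incr N u) 2 (gagliardoMeasure N s) := by
  have hm := measurable_incr hu
  rw [memLp_two_iff_integrable_sq hm.aestronglyMeasurable, gagliardo_eq_lintegral hu, Integrable,
    hasFiniteIntegral_iff_ofReal (Eventually.of_forall fun _ => sq_nonneg _)]
  exact (and_iff_right (hm.pow_const 2).aestronglyMeasurable).symm

lemma incr_ae_eq (h : u =ᵐ[volume] v) : incr N u =ᵐ[gagliardoMeasure N s] incr N v := by
  have h1 : (fun p : Euc N × Euc N => u p.1) =ᵐ[volume] fun p => v p.1 :=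
    Measure.quasiMeasurePreserving_fst.ae_eq_comp h
  have h2 : (fun p : Euc N × Euc N => u p.2) =ᵐ[volume] fun p => v p.2 :=
    Measure.quasiMeasurePreserving_snd.ae_eq_comp h
  exact withDensity_absolutelyContinuous _ _ (h1.sub h2)

lemma dform_congr (h : u =ᵐ[volume] v) : dform N s u φ = dform N s v φ := by
  rw [dform_eq_integral, dform_eq_integral]
  exact integral_congr_ae ((incr_ae_eq h).mul (ae_eq_refl _))

lemma gagliardo_congr (hu : Measurable u) (hv : Measurable v) (h : u =ᵐ[volume] v) :
    gagliardo N s u = gagliardo N s v := by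
  rw [gagliardo_eq_lintegral hu, gagliardo_eq_lintegral hv]
  refine lintegral_congr_ae ?_
  filter_upwards [incr_ae_eq h] with p hp
  rw [hp]

lemma gagliardo_mono (h : ∀ p, |incr N u p| ≤ |incr N v p|) :
    gagliardo N s u ≤ gagliardo N s v := by
  unfold gagliardo
  refine lintegral_mono fun x => lintegral_mono fun y => ENNReal.ofReal_le_ofReal ?_
  have := sq_le_sq.2 (h (x, y))
  simp only [incr] at this
  gcongr

lemma gagliardo_const_mul (hu : Measurable u) (c : ℝ) :
    gagliardo N s (fun x => c * u x) = ENNReal.ofReal (c ^ 2) * gagliardo N s u := by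
  rw [gagliardo_eq_lintegral hu, gagliardo_eq_lintegral (hu.const_mul c),
    ← lintegral_const_mul _ ((measurable_incr hu).pow_const 2).ennreal_ofReal]
  refine lintegral_congr fun p => ?_
  rw [← ENNReal.ofReal_mul (sq_nonneg c)]
  simp only [incr]
  ring_nf

lemma ofReal_dform_self (hu : Measurable u) (h : gagliardo N s u < ⊤) :
    ENNReal.ofReal (dform N s u u) = gagliardo N s u := by
  have hi := (memLp_two_iff_integrable_sq (measurable_incr hu).aestronglyMeasurable).1
    ((gagliardo_lt_top_iff hu).1 h)
  rw [gagliardo_eq_lintegral hu, dform_eq_integral]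
  simp_rw [← sq]
  exact ofReal_integral_eq_lintegral_ofReal hi (Eventually.of_forall fun _ => sq_nonneg _)

lemma memK_of_abs_incr_le {Ω : Set (Euc N)} {A B : ℝ} (hu : memK N s Ω u) (hv : memK N s Ω v)
    (hφ : Measurable φ) (h0 : ∀ x, v x = 0 → φ x = 0)
    (h : ∀ p, |incr N φ p| ≤ A * |incr N v p| + B * |incr N u p|) : memK N s Ω φ := by
  refine ⟨hφ, hv.2.1.mono fun x hx hxΩ => h0 x (hx hxΩ), (gagliardo_lt_top_iff hφ).2 ?_⟩
  have h1 := ((gagliardo_lt_top_iff hv.1).1 hv.2.2).norm.const_mul A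
  have h2 := ((gagliardo_lt_top_iff hu.1).1 hu.2.2).norm.const_mul B
  exact (h1.add h2).mono' (measurable_incr hφ).aestronglyMeasurable (Eventually.of_forall h)

lemma ofReal_integral_le_lintegral_ofReal {α : Type*} [MeasurableSpace α] {μ : Measure α}
    {f : α → ℝ} : ENNReal.ofReal (∫ x, f x ∂μ) ≤ ∫⁻ x, ENNReal.ofReal (f x) ∂μ := by
  by_cases hf : Integrable f μ
  · rw [integral_eq_lintegral_pos_part_sub_lintegral_neg_part hf]
    refine (ENNReal.ofReal_le_ofReal (sub_le_self _ ENNReal.toReal_nonneg)).trans ?_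
    exact ENNReal.ofReal_toReal_le
  · simp [integral_undef hf]

lemma ofReal_dform_le {q : ℝ} (hq : q ∈ Set.Ioc (1 : ℝ) 2) (hu : Measurable u) (hv : Measurable v)
    (h : ∀ p, incr N u p * incr N φ p ≤ |incr N v p| ^ q * |incr N u p| ^ (2 - q)) :
    ENNReal.ofReal (dform N s u φ) ≤ gagliardo N s v ^ (q / 2) * gagliardo N s u ^ (1 - q / 2) := by
  have hq0 := hq.1
  have hq2 := hq.2
  have key : ∀ t r : ℝ, 0 ≤ r → ENNReal.ofReal (|t| ^ (2 * r)) = ENNReal.ofReal (t ^ 2) ^ r := by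
    intro t r hr
    rw [ENNReal.ofReal_rpow_of_nonneg (sq_nonneg t) hr, ← sq_abs, Real.rpow_mul (abs_nonneg t),
      Real.rpow_two]
  rw [dform_eq_integral, gagliardo_eq_lintegral hu, gagliardo_eq_lintegral hv]
  refine ofReal_integral_le_lintegral_ofReal.trans (le_trans (lintegral_mono fun p => ?_)
    (ENNReal.lintegral_mul_norm_pow_le
      ((measurable_incr hv).pow_const 2).ennreal_ofReal.aemeasurable
      ((measurable_incr hu).pow_const 2).ennreal_ofReal.aemeasurable
      (by linarith) (by linarith) (by ring)))
  refine (ENNReal.ofReal_le_ofReal (h p)).trans ?_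
  rw [ENNReal.ofReal_mul (by positivity), ← key _ _ (by linarith), ← key _ _ (by linarith),
    show 2 * (q / 2) = q by ring, show 2 * (1 - q / 2) = 2 - q by ring]

end Form

lemma ae_eq_zero_of_tendsto_of_integral_nonpos {α : Type*} [MeasurableSpace α] {μ : Measure α}
    {f : ℕ → α → ℝ} {f₀ g : α → ℝ} (hf : ∀ n, Integrable (f n) μ) (hg : Integrable g μ)
    (hg0 : ∀ x, 0 ≤ g x) (hfg : ∀ n x, 0 ≤ f n x + g x) (hfi : ∀ n, ∫ x, f n x ∂μ ≤ 0)
    (hlim : ∀ x, Tendsto (fun n => f n x) atTop (𝓝 (f₀ x))) (hf₀ : ∀ x, 0 ≤ f₀ x) :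
    ∀ᵐ x ∂μ, f₀ x = 0 := by
  have hm₀ : AEMeasurable f₀ μ :=
    aemeasurable_of_tendsto_metrizable_ae' (fun n => (hf n).aemeasurable)
      (Eventually.of_forall hlim)
  have h1 : ∀ n, ∫⁻ x, ENNReal.ofReal (f n x + g x) ∂μ ≤ ∫⁻ x, ENNReal.ofReal (g x) ∂μ := by
    intro n
    have hi : Integrable (fun x => f n x + g x) μ := (hf n).add hg
    rw [← ofReal_integral_eq_lintegral_ofReal hi (Eventually.of_forall (hfg n)),
      ← ofReal_integral_eq_lintegral_ofReal hg (Eventually.of_forall hg0),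
      integral_add (hf n) hg]
    exact ENNReal.ofReal_le_ofReal (by linarith [hfi n])
  have h2 : ∫⁻ x, ENNReal.ofReal (f₀ x + g x) ∂μ ≤ ∫⁻ x, ENNReal.ofReal (g x) ∂μ := by
    calc ∫⁻ x, ENNReal.ofReal (f₀ x + g x) ∂μ
        = ∫⁻ x, liminf (fun n => ENNReal.ofReal (f n x + g x)) atTop ∂μ :=
          lintegral_congr fun x =>
            ((ENNReal.continuous_ofReal.tendsto _).comp
              ((hlim x).add_const (g x))).liminf_eq.symm
      _ ≤ liminf (fun n => ∫⁻ x, ENNReal.ofReal (f n x + g x) ∂μ) atTop :=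
          lintegral_liminf_le' fun n =>
            ((hf n).aemeasurable.add hg.aemeasurable).ennreal_ofReal
      _ ≤ _ := liminf_le_of_le (by isBoundedDefault) fun b hb => by
          obtain ⟨n, hn⟩ := hb.exists
          exact hn.trans (h1 n)
  simp_rw [fun x => ENNReal.ofReal_add (hf₀ x) (hg0 x)] at h2
  rw [lintegral_add_right' _ hg.aemeasurable.ennreal_ofReal] at h2
  have hfin : ∫⁻ x, ENNReal.ofReal (g x) ∂μ ≠ ⊤ := by
    rw [← ofReal_integral_eq_lintegral_ofReal hg (Eventually.of_forall hg0)]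
    exact ENNReal.ofReal_ne_top
  have h3 : ∫⁻ x, ENNReal.ofReal (f₀ x) ∂μ = 0 :=
    le_antisymm ((ENNReal.add_le_add_iff_right hfin).1 (h2.trans_eq (zero_add _).symm)) zero_le
  filter_upwards [(lintegral_eq_zero_iff' hm₀.ennreal_ofReal).1 h3] with x hx
  exact le_antisymm (ENNReal.ofReal_eq_zero.1 hx) (hf₀ x)

section Eigenfunction

variable {N : ℕ} {s q lam : ℝ} {Ω : Set (Euc N)} {u v : Euc N → ℝ}

lemma rpow_sub_two_mul_mul_self (hq : 0 < q) (t : ℝ) : |t| ^ (q - 2) * t * t = |t| ^ q := by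
  rcases eq_or_ne t 0 with rfl | ht
  · simp [hq.ne']
  · have h : 0 < |t| := abs_pos.2 ht
    rw [mul_assoc, ← abs_mul_abs_self t, ← sq, ← Real.rpow_two, ← Real.rpow_add h]
    ring_nf

lemma isEigenfunction.gagliardo_eq (hq : 0 < q) (hu : isEigenfunction N s q Ω lam u) :
    gagliardo N s u = ENNReal.ofReal (lam * (∫ x in Ω, |u x| ^ q) ^ (2 / q)) := by
  rw [← ofReal_dform_self hu.1.1 hu.1.2.2, hu.2.2 u hu.1]
  simp_rw [rpow_sub_two_mul_mul_self hq]
  rw [mul_assoc, ← Real.rpow_add_one hu.2.1.ne']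
  congr 3
  field_simp
  ring

lemma isEigenfunction.lambda1_le (hq : 0 < q) (hu : isEigenfunction N s q Ω lam u) :
    lambda1 N s q Ω ≤ ENNReal.ofReal lam := by
  set A := ∫ x in Ω, |u x| ^ q with hA
  have hA0 : 0 < A := hu.2.1
  set c := A ^ (-1 / q) with hc
  have hc0 : 0 < c := Real.rpow_pos_of_pos hA0 _
  have hG : gagliardo N s (fun x => c * u x) = ENNReal.ofReal lam := by
    rw [gagliardo_const_mul hu.1.1, hu.gagliardo_eq hq, ← ENNReal.ofReal_mul (sq_nonneg c),
      ← hA, hc, ← Real.rpow_two, ← Real.rpow_mul hA0.le, mul_left_comm, ← Real.rpow_add hA0]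
    ring_nf
    simp
  have hK : memK N s Ω (fun x => c * u x) :=
    ⟨hu.1.1.const_mul c, hu.1.2.1.mono fun x hx hxΩ => by simp [hx hxΩ],
      hG ▸ ENNReal.ofReal_lt_top⟩
  have h1 : ∫ x in Ω, |c * u x| ^ q = 1 := by
    simp_rw [abs_mul, Real.mul_rpow (abs_nonneg c) (abs_nonneg _), abs_of_pos hc0]
    rw [integral_const_mul, ← hA, hc, ← Real.rpow_mul hA0.le, ← Real.rpow_add_one hA0.ne',
      div_mul_cancel₀ _ hq.ne']
    simp
  exact (iInf₂_le _ ⟨hK, h1⟩).trans_eq hG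

lemma isEigenfunction.congr (hu : isEigenfunction N s q Ω lam u)
    (hv : Measurable v) (h : u =ᵐ[volume] v) : isEigenfunction N s q Ω lam v := by
  have hr : u =ᵐ[volume.restrict Ω] v := ae_restrict_of_ae h
  have hI : ∫ x in Ω, |v x| ^ q = ∫ x in Ω, |u x| ^ q :=
    integral_congr_ae (hr.mono fun x hx => by simp only [hx])
  refine ⟨⟨hv, ?_, ?_⟩, ?_, fun φ hφ => ?_⟩
  · filter_upwards [h, hu.1.2.1] with x hx h0 hxΩ
    rw [← hx, h0 hxΩ]
  · rw [← gagliardo_congr hu.1.1 hv h]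
    exact hu.1.2.2
  · rw [hI]
    exact hu.2.1
  · rw [hI, ← dform_congr h, hu.2.2 φ hφ]
    congr 1
    exact integral_congr_ae (hr.mono fun x hx => by simp only [hx])

/-- Nonlocal strong minimum principle. -/
lemma isEigenfunction.ae_eq_zero_of_eq_zero (hN : 1 ≤ N) (hq : 0 < q) (hlam : 0 ≤ lam)
    (hu : isEigenfunction N s q Ω lam u) (hu0 : ∀ x, 0 ≤ u x) {M : ℝ} (hv : memK N s Ω v)
    (hv0 : ∀ x, 0 ≤ v x) (hvM : ∀ x, v x ≤ M) : ∀ᵐ y, u y = 0 → v y = 0 := by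
  classical
  have hM : 0 ≤ M := (hv0 0).trans (hvM 0)
  let ψ : ℕ → ℝ → ℝ := fun n t => max (1 - n * t) 0
  let φ : ℕ → Euc N → ℝ := fun n x => v x * ψ n (u x)
  let φ₀ : Euc N → ℝ := fun x => if u x = 0 then v x else 0
  have hψ0 : ∀ n t, 0 ≤ ψ n t := fun n t => le_max_right _ _
  have hψ1 : ∀ n x, ψ n (u x) ≤ 1 := fun n x =>
    max_le (by have := hu0 x; simp only [sub_le_self_iff]; positivity) zero_le_one
  have hφK : ∀ n, memK N s Ω (φ n) := by
    intro n
    have hu1 := hu.1.1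
    have hv1 := hv.1
    refine memK_of_abs_incr_le (A := 1) (B := M * n) hu.1 hv ?_ (fun x hx => by simp [φ, hx])
      fun p => ?_
    · simp only [φ, ψ]
      fun_prop
    · refine (abs_mul_sub_mul_le (A := M) (B := 1)
        (by rw [abs_of_nonneg (hv0 _)]; exact hvM _)
        (by rw [abs_of_nonneg (hψ0 _ _)]; exact hψ1 _ _)).trans ?_
      have h1 : |ψ n (u p.1) - ψ n (u p.2)| ≤ n * |incr N u p| := by
        refine (abs_max_sub_max_le_abs _ _ _).trans_eq ?_
        rw [show (1 - n * u p.1 - (1 - n * u p.2) : ℝ) = -(n * incr N u p) by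
          simp only [incr]; ring, abs_neg, abs_mul, Nat.abs_cast]
      rw [mul_assoc M]
      exact add_le_add le_rfl (mul_le_mul_of_nonneg_left h1 hM)
  have hL : ∀ {w : Euc N → ℝ}, memK N s Ω w → MemLp (incr N w) 2 (gagliardoMeasure N s) :=
    fun hw => (gagliardo_lt_top_iff hw.1).1 hw.2.2
  have hT0 : ∀ p, 0 ≤ -(incr N u p * incr N φ₀ p) := by
    intro p
    have h1 := hu0 p.1
    have h2 := hu0 p.2
    have h3 := hv0 p.1
    have h4 := hv0 p.2
    simp only [incr, φ₀]
    split_ifs with ha hb hb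
    · simp [ha, hb]
    · rw [ha]; nlinarith [mul_nonneg h2 h3]
    · rw [hb]; nlinarith [mul_nonneg h1 h4]
    · simp
  have hae : ∀ᵐ p ∂gagliardoMeasure N s, -(incr N u p * incr N φ₀ p) = 0 := by
    refine ae_eq_zero_of_tendsto_of_integral_nonpos
      (f := fun n p => -(incr N u p * incr N (φ n) p)) (g := fun p => |incr N u p * incr N v p|)
      (fun n => ((hL hu.1).integrable_mul (hL (hφK n))).neg)
      ((hL hu.1).integrable_mul (hL hv)).abs (fun _ => abs_nonneg _) (fun n p => ?_)
      (fun n => ?_) (fun p => ?_) hT0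
    · have h1 : (u p.1 - u p.2) * (ψ n (u p.1) - ψ n (u p.2)) ≤ 0 := by
        have hanti : Antitone (ψ n) := fun a b hab => by
          simp only [ψ]
          gcongr
        rcases le_total (u p.1) (u p.2) with h | h
        · exact mul_nonpos_of_nonpos_of_nonneg (sub_nonpos.2 h) (sub_nonneg.2 (hanti h))
        · exact mul_nonpos_of_nonneg_of_nonpos (sub_nonneg.2 h) (sub_nonpos.2 (hanti h))
      have h2 : incr N u p * incr N v p * ψ n (u p.1) ≤ |incr N u p * incr N v p| :=
        calc _ ≤ |incr N u p * incr N v p| * ψ n (u p.1) :=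
              mul_le_mul_of_nonneg_right (le_abs_self _) (hψ0 _ _)
          _ ≤ _ := mul_le_of_le_one_right (abs_nonneg _) (hψ1 _ _)
      have h3 : incr N u p * incr N (φ n) p = incr N u p * incr N v p * ψ n (u p.1)
          + v p.2 * ((u p.1 - u p.2) * (ψ n (u p.1) - ψ n (u p.2))) := by
        simp only [incr, φ]
        ring
      have h4 := mul_nonpos_of_nonneg_of_nonpos (hv0 p.2) h1
      linarith
    · rw [integral_neg, ← dform_eq_integral, hu.2.2 _ (hφK n), neg_nonpos]
      refine mul_nonneg (mul_nonneg hlam (Real.rpow_nonneg hu.2.1.le _))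
        (integral_nonneg fun x => ?_)
      exact mul_nonneg (mul_nonneg (Real.rpow_nonneg (abs_nonneg _) _) (hu0 x))
        (mul_nonneg (hv0 x) (hψ0 _ _))
    · have hφ : ∀ x, Tendsto (fun n => φ n x) atTop (𝓝 (φ₀ x)) := by
        intro x
        by_cases hx : u x = 0
        · simp [φ, φ₀, ψ, hx]
        · have hx' : 0 < u x := (hu0 x).lt_of_ne' hx
          refine tendsto_const_nhds.congr' ?_
          filter_upwards [eventually_ge_atTop ⌈1 / u x⌉₊] with n hn
          have h1 : 1 / u x ≤ n := (Nat.le_ceil _).trans (by exact_mod_cast hn)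
          rw [div_le_iff₀ hx'] at h1
          simp only [φ, φ₀, ψ, if_neg hx]
          rw [max_eq_right (by linarith), mul_zero]
      exact (((hφ p.1).sub (hφ p.2)).const_mul (incr N u p)).neg
  have hvol : ∀ᵐ p : Euc N × Euc N ∂(volume.prod volume),
      gagliardoKernel N s p ≠ 0 → -(incr N u p * incr N φ₀ p) = 0 :=
    (ae_withDensity_iff measurable_gagliardoKernel).1 hae
  have hfreq : ∃ᶠ x in ae (volume : Measure (Euc N)), u x ≠ 0 := by
    intro h
    refine hu.2.1.ne' (integral_eq_zero_of_ae (ae_restrict_of_ae ?_))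
    filter_upwards [h] with x hx
    rw [not_not.1 hx, abs_zero, Real.zero_rpow hq.ne', Pi.zero_apply]
  obtain ⟨x, hx, hxy⟩ := (hfreq.and_eventually (Measure.ae_ae_of_ae_prod hvol)).exists
  have : Nonempty (Fin N) := ⟨⟨0, hN⟩⟩
  filter_upwards [hxy, Measure.ae_ne volume x] with y hy hyx huy
  have hk : gagliardoKernel N s (x, y) ≠ 0 := by
    have : 0 < ‖x - y‖ := norm_pos_iff.2 (sub_ne_zero.2 hyx.symm)
    exact (ENNReal.ofReal_pos.2 (by positivity)).ne'
  have := hy hk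
  simpa [incr, φ₀, hx, huy] using this

end Eigenfunction

section UpperBound

variable {N : ℕ} {s q lam : ℝ} {Ω : Set (Euc N)} {u v : Euc N → ℝ}

/-- The truncation `min(|v|, n)`. -/
def truncAbs (v : Euc N → ℝ) (n : ℕ) (x : Euc N) : ℝ := min |v x| n

lemma truncAbs_mem_Icc (n : ℕ) (x : Euc N) : truncAbs v n x ∈ Set.Icc (0 : ℝ) n :=
  ⟨le_min (abs_nonneg _) n.cast_nonneg, min_le_right _ _⟩

lemma abs_incr_truncAbs_le (n : ℕ) (p : Euc N × Euc N) :
    |incr N (truncAbs v n) p| ≤ |incr N v p| := by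
  refine (abs_min_sub_min_le_max _ _ _ _).trans ?_
  rw [sub_self, abs_zero]
  exact max_le (abs_abs_sub_abs_le _ _) (abs_nonneg _)

lemma measurable_truncAbs (hv : Measurable v) (n : ℕ) : Measurable (truncAbs v n) := by
  unfold truncAbs
  fun_prop

lemma memK_truncAbs (hv : memK N s Ω v) (n : ℕ) : memK N s Ω (truncAbs v n) := by
  refine memK_of_abs_incr_le (A := 1) (B := 0) hv hv (measurable_truncAbs hv.1 n)
    (fun x hx => by simp [truncAbs, hx]) fun p => ?_
  simpa using abs_incr_truncAbs_le n p

lemma tendsto_truncAbs (x : Euc N) : Tendsto (fun n => truncAbs v n x) atTop (𝓝 |v x|) := by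
  refine tendsto_const_nhds.congr' ?_
  filter_upwards [eventually_ge_atTop ⌈|v x|⌉₊] with n hn
  exact (min_eq_left ((Nat.le_ceil _).trans (by exact_mod_cast hn))).symm

/-- The Picone test function `min(|v|, n)^q / (u + 1/(n+1))^{q-1}`. -/
def piconeTest (q : ℝ) (u v : Euc N → ℝ) (n : ℕ) (x : Euc N) : ℝ :=
  truncAbs v n x ^ q * (u x + 1 / ((n : ℝ) + 1)) ^ (1 - q)

lemma measurable_piconeTest (hu : Measurable u) (hv : Measurable v) (n : ℕ) :
    Measurable (piconeTest q u v n) := by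
  have := measurable_truncAbs hv n
  unfold piconeTest
  fun_prop

lemma memK_piconeTest (hq : 1 ≤ q) (hu : memK N s Ω u) (hu0 : ∀ x, 0 ≤ u x)
    (hv : memK N s Ω v) (n : ℕ) : memK N s Ω (piconeTest q u v n) := by
  set ε : ℝ := 1 / ((n : ℝ) + 1) with hε
  have hε0 : 0 < ε := by positivity
  have huε : ∀ x, ε ≤ u x + ε := fun x => le_add_of_nonneg_left (hu0 x)
  refine memK_of_abs_incr_le (A := ε ^ (1 - q) * (q * (n : ℝ) ^ (q - 1)))
    (B := (n : ℝ) ^ q * ((q - 1) * ε ^ (-q))) hu hv (measurable_piconeTest hu.1 hv.1 n)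
    (fun x hx => by simp [piconeTest, truncAbs, hx, (by linarith : q ≠ 0)]) fun p => ?_
  refine (abs_mul_sub_mul_le (A := (n : ℝ) ^ q) (B := ε ^ (1 - q)) ?_ ?_).trans ?_
  · obtain ⟨h1, h2⟩ := truncAbs_mem_Icc (v := v) n p.2
    rw [abs_of_nonneg (Real.rpow_nonneg h1 _)]
    exact Real.rpow_le_rpow h1 h2 (by linarith)
  · rw [abs_of_nonneg (Real.rpow_nonneg (hε0.le.trans (huε _)) _)]
    exact Real.rpow_le_rpow_of_nonpos hε0 (huε _) (by linarith)
  · have h1 := (abs_rpow_sub_rpow_le hq (truncAbs_mem_Icc (v := v) n p.1)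
      (truncAbs_mem_Icc (v := v) n p.2)).trans
      (mul_le_mul_of_nonneg_left (abs_incr_truncAbs_le n p) (by positivity))
    have h2 := abs_rpow_one_sub_sub_le hq hε0 (huε p.1) (huε p.2)
    rw [add_sub_add_right_eq_sub] at h2
    rw [mul_assoc (ε ^ (1 - q)), mul_assoc ((n : ℝ) ^ q)]
    exact add_le_add (mul_le_mul_of_nonneg_left h1 (by positivity))
      (mul_le_mul_of_nonneg_left h2 (by positivity))

lemma ofReal_dform_piconeTest_le (hq : q ∈ Set.Ioc (1 : ℝ) 2) (hu : Measurable u)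
    (hu0 : ∀ x, 0 ≤ u x) (hv : Measurable v) (n : ℕ) :
    ENNReal.ofReal (dform N s u (piconeTest q u v n))
      ≤ gagliardo N s v ^ (q / 2) * gagliardo N s u ^ (1 - q / 2) := by
  have hε0 : (0 : ℝ) < 1 / ((n : ℝ) + 1) := by positivity
  refine ofReal_dform_le hq hu hv fun p => ?_
  have h := discrete_picone hq.1.le (add_pos_of_nonneg_of_pos (hu0 p.1) hε0)
    (add_pos_of_nonneg_of_pos (hu0 p.2) hε0) (truncAbs_mem_Icc (v := v) n p.1).1
    (truncAbs_mem_Icc (v := v) n p.2).1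
  rw [add_sub_add_right_eq_sub] at h
  refine h.trans (mul_le_mul_of_nonneg_right ?_ (Real.rpow_nonneg (abs_nonneg _) _))
  exact Real.rpow_le_rpow (abs_nonneg _) (abs_incr_truncAbs_le n p) (by linarith [hq.1])

lemma tendsto_integral_mul_piconeTest (hq : 1 < q) (hu : Measurable u) (hu0 : ∀ x, 0 ≤ u x)
    (hv : Measurable v) (hfi : IntegrableOn (fun x => |v x| ^ q) Ω)
    (h0 : ∀ᵐ x, u x = 0 → v x = 0) :
    Tendsto (fun n => ∫ x in Ω, |u x| ^ (q - 2) * u x * piconeTest q u v n x) atTop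
      (𝓝 (∫ x in Ω, |v x| ^ q)) := by
  refine tendsto_integral_of_dominated_convergence (fun x => |v x| ^ q) (fun n => ?_) hfi
    (fun n => Eventually.of_forall fun x => ?_) ?_
  · have := measurable_piconeTest (q := q) hu hv n
    exact Measurable.aestronglyMeasurable (by fun_prop)
  · have hx := hu0 x
    have hε0 : (0 : ℝ) < 1 / ((n : ℝ) + 1) := by positivity
    obtain ⟨h1, -⟩ := truncAbs_mem_Icc (v := v) n x
    have h2 : truncAbs v n x ≤ |v x| := min_le_left _ _
    have h3 := Real.rpow_le_rpow h1 h2 (by linarith : 0 ≤ q)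
    rw [Real.norm_of_nonneg (by unfold piconeTest; positivity), abs_of_nonneg hx, piconeTest]
    rcases hx.eq_or_lt with hx | hx
    · rw [← hx, mul_zero, zero_mul]
      positivity
    · have h4 : u x ^ (q - 2) * u x = u x ^ (q - 1) := by
        rw [← Real.rpow_add_one hx.ne']
        ring_nf
      have h5 : u x ^ (q - 1) * (u x + 1 / ((n : ℝ) + 1)) ^ (1 - q) ≤ 1 :=
        calc _ ≤ u x ^ (q - 1) * u x ^ (1 - q) :=
              mul_le_mul_of_nonneg_left
                (Real.rpow_le_rpow_of_nonpos hx (by linarith) (by linarith)) (by positivity)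
          _ = 1 := by rw [← Real.rpow_add hx]; simp
      rw [h4, mul_left_comm]
      exact (mul_le_of_le_one_right (Real.rpow_nonneg h1 _) h5).trans h3
  · refine ae_restrict_of_ae ?_
    filter_upwards [h0] with x hx
    rcases (hu0 x).eq_or_lt with h | h
    · simp [← h, hx h.symm, (by linarith : q ≠ 0)]
    · have h1 : Tendsto (fun n : ℕ => (u x + 1 / ((n : ℝ) + 1)) ^ (1 - q)) atTop
          (𝓝 ((u x + 0) ^ (1 - q))) :=
        (tendsto_one_div_add_atTop_nhds_zero_nat.const_add (u x)).rpow_const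
          (Or.inl (by simpa using h.ne'))
      have h2 := (((tendsto_truncAbs (v := v) x).rpow_const (p := q)
        (Or.inr (by linarith))).mul h1).const_mul (|u x| ^ (q - 2) * u x)
      have h3 : |u x| ^ (q - 2) * u x * (|v x| ^ q * (u x + 0) ^ (1 - q)) = |v x| ^ q := by
        rw [add_zero, abs_of_pos h, ← Real.rpow_add_one h.ne', mul_left_comm, ← Real.rpow_add h]
        ring_nf
        simp
      rwa [h3] at h2

lemma isEigenfunction.ofReal_le_gagliardo (hN : 1 ≤ N) (hq : q ∈ Set.Ioc (1 : ℝ) 2)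
    (hlam : 0 < lam) (hu : isEigenfunction N s q Ω lam u) (hu0 : ∀ x, 0 ≤ u x)
    (hv : memK N s Ω v) (hv1 : ∫ x in Ω, |v x| ^ q = 1) :
    ENNReal.ofReal lam ≤ gagliardo N s v := by
  have hq0 : 0 < q := by linarith [hq.1]
  have hfi : IntegrableOn (fun x => |v x| ^ q) Ω := by
    by_contra h
    rw [integral_undef h] at hv1
    exact zero_ne_one hv1
  have h0 : ∀ᵐ x, u x = 0 → v x = 0 := by
    filter_upwards [hu.ae_eq_zero_of_eq_zero hN hq0 hlam.le hu0 (memK_truncAbs hv 1)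
      (fun x => (truncAbs_mem_Icc 1 x).1) (fun x => (truncAbs_mem_Icc 1 x).2)] with x hx hux
    have h := hx hux
    by_contra hvx
    exact (lt_min (abs_pos.2 hvx) (by simp : (0 : ℝ) < (1 : ℕ))).ne' h
  set A := ∫ x in Ω, |u x| ^ q with hA
  have hA0 : 0 < A := hu.2.1
  have hlim : Tendsto (fun n => ENNReal.ofReal (dform N s u (piconeTest q u v n))) atTop
      (𝓝 (ENNReal.ofReal (lam * A ^ ((2 - q) / q)))) := by
    refine (ENNReal.continuous_ofReal.tendsto _).comp ?_
    have := (tendsto_integral_mul_piconeTest hq.1 hu.1.1 hu0 hv.1 hfi h0).const_mul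
      (lam * A ^ ((2 - q) / q))
    rw [hv1, mul_one] at this
    exact this.congr fun n => (hu.2.2 _ (memK_piconeTest hq.1.le hu.1 hu0 hv n)).symm
  have hle := le_of_tendsto' hlim fun n => ofReal_dform_piconeTest_le hq hu.1.1 hu0 hv.1 n
  have h2q : 0 ≤ 1 - q / 2 := by linarith [hq.2]
  rw [hu.gagliardo_eq hq0, ← ENNReal.ofReal_toReal hv.2.2.ne] at hle
  rw [← ENNReal.ofReal_toReal hv.2.2.ne]
  set g := (gagliardo N s v).toReal
  have hg : 0 ≤ g := ENNReal.toReal_nonneg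
  rw [ENNReal.ofReal_rpow_of_nonneg hg (by positivity),
    ENNReal.ofReal_rpow_of_nonneg (by positivity) h2q, ← ENNReal.ofReal_mul (by positivity),
    ENNReal.ofReal_le_ofReal_iff (by positivity), ← hA, Real.mul_rpow hlam.le (by positivity),
    ← Real.rpow_mul hA0.le, show 2 / q * (1 - q / 2) = (2 - q) / q by field_simp,
    ← mul_assoc] at hle
  have h1 := le_of_mul_le_mul_right hle (Real.rpow_pos_of_pos hA0 _)
  have h2 : lam = lam ^ (q / 2) * lam ^ (1 - q / 2) := by
    rw [← Real.rpow_add hlam]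
    simp
  nth_rewrite 1 [h2] at h1
  have h3 := le_of_mul_le_mul_right h1 (Real.rpow_pos_of_pos hlam _)
  exact ENNReal.ofReal_le_ofReal ((Real.rpow_le_rpow_iff hlam.le hg (by positivity)).1 h3)

end UpperBound

/-- for `q ∈ (1,2]`, an eigenvalue with a nonnegative eigenfunction is the first one. -/
theorem stmt_2 (N : ℕ) (hN : 1 ≤ N) (s : ℝ) (hs : s ∈ Set.Ioo (0 : ℝ) 1)
    (q : ℝ) (hq : q ∈ Set.Ioc (1 : ℝ) 2)
    (Ω : Set (Euc N)) (hΩ : IsOpen Ω) (hpos : 0 < lambda1 N s q Ω)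
    (hcpt : compactEmbed N s q Ω)
    (lam : ℝ) (hlam : 0 < lam) (u : Euc N → ℝ)
    (hu : isEigenfunction N s q Ω lam u)
    (hnn : ∀ᵐ x ∂volume.restrict Ω, 0 ≤ u x) :
    ENNReal.ofReal lam = lambda1 N s q Ω := by
  have hq0 : 0 < q := by linarith [hq.1]
  refine le_antisymm (le_iInf₂ fun v hv => ?_) (hu.lambda1_le hq0)
  have hae : u =ᵐ[volume] fun x => max (u x) 0 := by
    filter_upwards [hu.1.2.1, (ae_restrict_iff' hΩ.measurableSet).1 hnn] with x h1 h2
    by_cases hx : x ∈ Ω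
    · exact (max_eq_left (h2 hx)).symm
    · simp [h1 hx]
  exact (hu.congr (hu.1.1.max measurable_const) hae).ofReal_le_gagliardo hN hq hlam
    (fun x => le_max_right _ _) hv.1 hv.2
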